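/- arXiv:2309.12623 — 5 statements merged into one kernel-verified Lean document; each statement's English description precedes it below -/
import Mathlib

section
/- After Integrated SpaceSaving± with m ≥ 1 counters processes a valid stream σ, the sum of the insert counts insert_e over all monitored items e equals I, the total number of insertion operations in σ. -/
/-!
Streams of insert/delete operations over a universe `U`, and the
Integrated SpaceSaving± summary, formalized as an association list
`List (U × ℕ × ℕ)` of (item, insert count, delete count) entries.
`true` encodes an insertion, `false` a deletion.
-/

namespace SSPM

variable {U : Type} [DecidableEq U]

/-- A stream: list of (item, operation) pairs; `true` = insertion, `false` = deletion. -/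
abbrev Stream (U : Type) := List (U × Bool)

/-- Number of insertions of `x` in `σ`. -/
def insCount (σ : Stream U) (x : U) : ℕ := σ.countP (fun p => p.1 == x && p.2)

/-- Number of deletions of `x` in `σ`. -/
def delCount (σ : Stream U) (x : U) : ℕ := σ.countP (fun p => p.1 == x && !p.2)

/-- Total number of insertion operations `I`. -/
def totalI (σ : Stream U) : ℕ := σ.countP (fun p => p.2)

/-- Total number of deletion operations `D`. -/
def totalD (σ : Stream U) : ℕ := σ.countP (fun p => !p.2)

/-- Frequency `f(x) = I(x) - D(x)`. -/
def freq (σ : Stream U) (x : U) : ℤ := (insCount σ x : ℤ) - (delCount σ x : ℤ)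

/-- `F1 = I - D`. -/
def F1 (σ : Stream U) : ℤ := (totalI σ : ℤ) - (totalD σ : ℤ)

/-- A stream is valid if in every prefix every item has at least as many
insertions as deletions. -/
def Valid (σ : Stream U) : Prop :=
  ∀ τ : Stream U, τ <+: σ → ∀ x : U, delCount τ x ≤ insCount τ x

/-- `α`-bounded-deletion property: `D ≤ (1 - 1/α) I`. -/
def BoundedDel (α : ℝ) (σ : Stream U) : Prop :=
  (totalD σ : ℝ) ≤ (1 - 1 / α) * (totalI σ : ℝ)

/-- State of Integrated SpaceSaving±: association list of
(item, insert count, delete count). -/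
abbrev ISSState (U : Type) := List (U × ℕ × ℕ)

/-- One step of the Integrated SpaceSaving± update algorithm with `m` counters. -/
def issStep (m : ℕ) (S : ISSState U) (p : U × Bool) : ISSState U :=
  match p with
  | (e, true) =>
    match S.find? (fun q => q.1 == e) with
    | some q => (e, q.2.1 + 1, q.2.2) :: S.eraseP (fun q => q.1 == e)
    | none =>
      if S.length < m then (e, 1, 0) :: S
      else
        match S.argmin (fun q => q.2.1) with
        | some q => (e, q.2.1 + 1, 0) :: S.eraseP (fun r => r.1 == q.1)
        | none => S
  | (e, false) =>
    match S.find? (fun q => q.1 == e) with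
    | some q => (e, q.2.1, q.2.2 + 1) :: S.eraseP (fun q => q.1 == e)
    | none => S

/-- Run Integrated SpaceSaving± with `m` counters on stream `σ`. -/
def issRun (m : ℕ) (σ : Stream U) : ISSState U := σ.foldl (issStep m) []

/-- An item is monitored if it is in the summary. -/
def Monitored (S : ISSState U) (x : U) : Prop := (S.find? (fun q => q.1 == x)).isSome

/-- Query: `f̂(x) = insert_x - delete_x` if `x` is monitored, `0` otherwise. -/
def issQuery (S : ISSState U) (x : U) : ℤ :=
  match S.find? (fun q => q.1 == x) with
  | some q => (q.2.1 : ℤ) - (q.2.2 : ℤ)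
  | none => 0

/-- The insert count of a monitored item (`0` for unmonitored items). -/
def insertCountOf (S : ISSState U) (x : U) : ℕ :=
  match S.find? (fun q => q.1 == x) with
  | some q => q.2.1
  | none => 0

/-- `insert_minItem`: the minimum insert count over monitored items when the
summary is full (has exactly `m` entries), and `0` otherwise. -/
def minInsert (m : ℕ) (S : ISSState U) : ℕ :=
  if S.length = m then
    match S.argmin (fun q => q.2.1) with
    | some q => q.2.1
    | none => 0
  else 0

/-- Erasing the first element satisfying `p` removes exactly the element found by `find?`. -/
theorem perm_cons_eraseP_of_find? {α : Type*} {p : α → Bool} {l : List α} {a : α}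
    (h : l.find? p = some a) : l.Perm (a :: l.eraseP p) := by
  induction l with
  | nil => simp at h
  | cons b l ih =>
    by_cases hb : p b = true
    · simp_all
    · have hb' : p b = false := by simpa using hb
      simp only [List.find?_cons, hb'] at h
      rw [List.eraseP_cons_of_neg hb]
      exact ((ih h).cons b).trans (List.Perm.swap a b _)

/-- In a summary with distinct keys, looking up the key of an entry returns that entry. -/
theorem find?_key_eq_some {S : ISSState U} (hS : (S.map Prod.fst).Nodup) {q : U × ℕ × ℕ}
    (hq : q ∈ S) : S.find? (fun r => r.1 == q.1) = some q := by
  induction S with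
  | nil => simp at hq
  | cons b S ih =>
    simp only [List.map_cons, List.nodup_cons] at hS
    rcases List.mem_cons.1 hq with rfl | hq'
    · simp
    · have hne : b.1 ≠ q.1 := fun h => hS.1 (h ▸ List.mem_map_of_mem hq')
      simpa [List.find?_cons, hne] using ih hS.2 hq'

/-- Each step keeps the keys distinct, and increases the sum of the insert counts by one
on insertions only. -/
theorem issStep_nodup_and_sum {m : ℕ} (hm : 1 ≤ m) {S : ISSState U}
    (hS : (S.map Prod.fst).Nodup) (p : U × Bool) :
    ((issStep m S p).map Prod.fst).Nodup ∧
      ((issStep m S p).map (fun q => q.2.1)).sum =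
        (S.map (fun q => q.2.1)).sum + if p.2 then 1 else 0 := by
  have split_off {P : U × ℕ × ℕ → Bool} {q : U × ℕ × ℕ} (hq : S.find? P = some q) :
      (q.1 ∉ (S.eraseP P).map Prod.fst ∧ ((S.eraseP P).map Prod.fst).Nodup) ∧
        (S.map (fun q => q.2.1)).sum = q.2.1 + ((S.eraseP P).map (fun q => q.2.1)).sum := by
    have hperm := perm_cons_eraseP_of_find? hq
    refine ⟨?_, ?_⟩
    · simpa only [List.map_cons, List.nodup_cons] using (hperm.map Prod.fst).nodup_iff.1 hS
    · simpa only [List.map_cons, List.sum_cons] using (hperm.map (fun q => q.2.1)).sum_eq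
  obtain ⟨e, b⟩ := p
  cases hf : S.find? (fun q => q.1 == e) with
  | some q =>
    obtain ⟨hn, hs⟩ := split_off hf
    have hqe : q.1 = e := by simpa using List.find?_some hf
    rw [hqe] at hn
    cases b
    · simp only [issStep, hf, List.map_cons, List.nodup_cons, List.sum_cons]
      exact ⟨hn, by simp [hs]⟩
    · simp only [issStep, hf, List.map_cons, List.nodup_cons, List.sum_cons]
      exact ⟨hn, by simp only [hs, if_true]; omega⟩
  | none =>
    have he : e ∉ S.map Prod.fst := by
      intro h
      obtain ⟨q, hq, rfl⟩ := List.mem_map.1 h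
      simpa using List.find?_eq_none.1 hf q hq
    cases b
    · simpa [issStep, hf] using hS
    · by_cases hlen : S.length < m
      · simp only [issStep, hf, hlen, if_true, List.map_cons, List.nodup_cons, List.sum_cons]
        exact ⟨⟨he, hS⟩, add_comm _ _⟩
      · cases ha : S.argmin (fun q => q.2.1) with
        | none =>
          rw [List.argmin_eq_none] at ha
          simp [ha] at hlen
          omega
        | some q =>
          obtain ⟨hn, hs⟩ := split_off (find?_key_eq_some hS (List.argmin_mem ha))
          simp only [issStep, hf, hlen, ha, if_false, if_true, List.map_cons, List.nodup_cons,
            List.sum_cons]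
          exact ⟨⟨fun h => he ((List.eraseP_sublist.map Prod.fst).subset h), hn.2⟩, by omega⟩

/-- Starting from a summary with distinct keys, the sum of the insert counts grows by the number
of insertions processed. -/
theorem sum_foldl_issStep {m : ℕ} (hm : 1 ≤ m) (σ : Stream U) {S : ISSState U}
    (hS : (S.map Prod.fst).Nodup) :
    ((σ.foldl (issStep m) S).map (fun q => q.2.1)).sum =
      (S.map (fun q => q.2.1)).sum + totalI σ := by
  induction σ generalizing S with
  | nil => simp [totalI]
  | cons p σ ih =>
    obtain ⟨hn, hs⟩ := issStep_nodup_and_sum hm hS p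
    rw [List.foldl_cons, ih hn, hs, totalI, totalI, List.countP_cons]
    omega

/-- After Integrated SpaceSaving± with m ≥ 1 counters processes a
valid stream σ, the sum of the insert counts over all monitored items equals I,
the total number of insertion operations in σ. -/
theorem iss_sum_insert_counts_eq_totalI (m : ℕ) (hm : 1 ≤ m)
    (σ : Stream U) (hσ : Valid σ) :
    ((issRun m σ).map (fun q => q.2.1)).sum = totalI σ := by
  simpa [issRun] using sum_foldl_issStep hm σ (S := []) (by simp)

end SSPM
end

section
/- After Integrated SpaceSaving± with m ≥ 1 counters processes a valid stream σ, the minimum insert count satisfies insert_minItem ≤ I/m (as a real number), where I is the total number of insertion operations in σ. -/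
/-!
Streams of insert/delete operations over a universe `U`, and the
Integrated SpaceSaving± summary, formalized as an association list
`List (U × ℕ × ℕ)` of (item, insert count, delete count) entries.
`true` encodes an insertion, `false` a deletion.
-/

namespace SSPM

variable {U : Type} [DecidableEq U]

/-- The sum of all insert counts in the summary. -/
def sumInserts (S : ISSState U) : ℕ := (S.map (fun q => q.2.1)).sum

theorem sumInserts_eraseP {V : Type} {P : V × ℕ × ℕ → Bool} {S : ISSState V} {q : V × ℕ × ℕ}
    (h : S.find? P = some q) : q.2.1 + sumInserts (S.eraseP P) = sumInserts S := by
  induction S with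
  | nil => simp at h
  | cons a S ih =>
    by_cases ha : P a = true
    · simp_all [sumInserts]
    · simp only [List.find?_cons, ha] at h
      have := ih h
      simp only [sumInserts, List.eraseP_cons, ha, List.map_cons, List.sum_cons,
        Bool.cond_false] at *
      omega

theorem sumInserts_issStep_le (m : ℕ) (S : ISSState U) (p : U × Bool) :
    sumInserts (issStep m S p) ≤ sumInserts S + p.2.toNat := by
  obtain ⟨e, _ | _⟩ := p
  · simp only [issStep]
    split
    · next q hq =>
      have := sumInserts_eraseP hq
      simp only [sumInserts, List.map_cons, List.sum_cons] at *
      omega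
    · simp
  · simp only [issStep, Bool.toNat_true]
    split
    · next q hq =>
      have := sumInserts_eraseP hq
      simp only [sumInserts, List.map_cons, List.sum_cons] at *
      omega
    · split
      · simp [sumInserts, add_comm]
      · split
        · next q hq =>
          have hfind : (S.find? (fun r => r.1 == q.1)).isSome := by
            rw [List.find?_isSome]
            exact ⟨q, List.argmin_mem hq, by simp⟩
          obtain ⟨r, hr⟩ := Option.isSome_iff_exists.mp hfind
          have hle : q.2.1 ≤ r.2.1 :=
            List.le_of_mem_argmin (f := fun q => q.2.1) (List.mem_of_find?_eq_some hr) hq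
          have := sumInserts_eraseP hr
          simp only [sumInserts, List.map_cons, List.sum_cons] at *
          omega
        · omega

theorem sumInserts_issRun_le (m : ℕ) (σ : Stream U) :
    sumInserts (issRun m σ) ≤ totalI σ := by
  induction σ using List.reverseRecOn with
  | nil => simp [sumInserts, issRun]
  | append_singleton σ p ih =>
    have hstep := sumInserts_issStep_le m (issRun m σ) p
    have hrun : issRun m (σ ++ [p]) = issStep m (issRun m σ) p := by simp [issRun]
    have htotal : totalI (σ ++ [p]) = totalI σ + p.2.toNat := by
      cases h : p.2 <;> simp [totalI, h]
    rw [hrun, htotal]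
    omega

theorem mul_minInsert_le_sumInserts {V : Type} (m : ℕ) (S : ISSState V) :
    m * minInsert m S ≤ sumInserts S := by
  unfold minInsert
  split
  · next hlen =>
    split
    · next q hq =>
      have := List.card_nsmul_le_sum (S.map (fun q => q.2.1)) q.2.1 (by
        intro x hx
        obtain ⟨r, hr, rfl⟩ := List.mem_map.mp hx
        exact List.le_of_mem_argmin (f := fun q => q.2.1) hr hq)
      simpa [sumInserts, hlen] using this
    · simp
  · simp

/-- After Integrated SpaceSaving± with m ≥ 1 counters processes a
valid stream σ, the minimum insert count satisfies insert_minItem ≤ I/m. -/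
theorem iss_minInsert_le (m : ℕ) (hm : 1 ≤ m) (σ : Stream U) (hσ : Valid σ) :
    (minInsert m (issRun m σ) : ℝ) ≤ (totalI σ : ℝ) / (m : ℝ) := by
  rw [le_div_iff₀ (by exact_mod_cast hm), mul_comm]
  exact_mod_cast (mul_minInsert_le_sumInserts m _).trans (sumInserts_issRun_le m σ)

end SSPM
end

section
/- After Integrated SpaceSaving± with m counters processes a valid stream σ, every monitored item x satisfies f̂(x) ≥ f(x); that is, the frequency of a monitored item is never underestimated. -/
/-!
Streams of insert/delete operations over a universe `U`, and the
Integrated SpaceSaving± summary, formalized as an association list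
`List (U × ℕ × ℕ)` of (item, insert count, delete count) entries.
`true` encodes an insertion, `false` a deletion.
-/

namespace SSPM

variable {U : Type} [DecidableEq U]

theorem mem_eraseP_key_iff {S : ISSState U} (hS : S.Pairwise (fun a b => a.1 ≠ b.1)) (k : U)
    (r : U × ℕ × ℕ) : r ∈ S.eraseP (fun q => q.1 == k) ↔ r ∈ S ∧ r.1 ≠ k := by
  induction S with
  | nil => simp
  | cons a S ih =>
    rw [List.pairwise_cons] at hS
    by_cases h : a.1 = k
    · have := hS.1 r
      simp only [List.eraseP_cons, h, beq_self_eq_true, cond_true, List.mem_cons]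
      grind
    · simp only [List.eraseP_cons, beq_eq_false_iff_ne.mpr h, cond_false, List.mem_cons, ih hS.2]
      grind

theorem length_cons_eraseP_key {S : ISSState U} {q a : U × ℕ × ℕ} (hq : q ∈ S) :
    (a :: S.eraseP (fun r => r.1 == q.1)).length = S.length := by
  have := List.length_pos_of_mem hq
  rw [List.length_cons, List.length_eraseP_of_mem hq (by simp)]
  omega

/-- The summary `S` with `m` counters dominates the frequencies `g`: keys are distinct, the estimate
of every entry is an upper bound, and the frequency of an item without an entry is at most every
insert count, and at most `0` while counters are free. -/
structure Dominates (m : ℕ) (g : U → ℤ) (S : ISSState U) : Prop where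
  pairwise : S.Pairwise (fun a b => a.1 ≠ b.1)
  le_estimate : ∀ q ∈ S, g q.1 ≤ (q.2.1 : ℤ) - q.2.2
  le_zero : ∀ x, (∀ q ∈ S, q.1 ≠ x) → S.length < m → g x ≤ 0
  le_insert : ∀ x, (∀ q ∈ S, q.1 ≠ x) → ∀ q ∈ S, g x ≤ q.2.1

theorem Dominates.replace {m : ℕ} {g g' : U → ℤ} {S : ISSState U} (h : Dominates m g S)
    {e : U} {i d : ℕ} {q : U × ℕ × ℕ} (hq : q ∈ S) (hle : q.2.1 ≤ i)
    (hkey : q.1 = e ∨ (∀ r ∈ S, r.1 ≠ e) ∧ m ≤ S.length ∧ ∀ r ∈ S, q.2.1 ≤ r.2.1)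
    (he : g' e ≤ (i : ℤ) - d) (hne : ∀ x, x ≠ e → g' x ≤ g x) :
    Dominates m g' ((e, i, d) :: S.eraseP (fun r => r.1 == q.1)) := by
  have hmem := mem_eraseP_key_iff h.pairwise q.1
  have hest := h.le_estimate
  have hins := h.le_insert
  refine ⟨?_, ?_, ?_, ?_⟩
  · refine List.pairwise_cons.mpr ⟨?_, h.pairwise.sublist List.eraseP_sublist⟩
    intro r hr
    have := (hmem r).mp hr
    grind
  · intro r hr
    rcases List.mem_cons.mp hr with rfl | hr
    · exact he
    · have := (hmem r).mp hr
      have hre : r.1 ≠ e := by grind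
      exact (hne _ hre).trans (hest r this.1)
  · intro x hx hlen
    rw [length_cons_eraseP_key hq] at hlen
    have hxe : x ≠ e := fun hxe => hx _ List.mem_cons_self hxe.symm
    refine (hne x hxe).trans (h.le_zero x (fun r hr hrx => ?_) hlen)
    have := hx r
    grind
  · intro x hx r hr
    have hxe : x ≠ e := fun hxe => hx _ List.mem_cons_self hxe.symm
    refine (hne x hxe).trans ?_
    by_cases hxq : q.1 = x
    · have hgx : g x ≤ q.2.1 := by
        have := hest q hq
        rw [hxq] at this
        omega
      rcases List.mem_cons.mp hr with rfl | hr
      · exact hgx.trans (by exact_mod_cast hle)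
      · have := (hmem r).mp hr
        grind
    · have hxS : ∀ r ∈ S, r.1 ≠ x := by
        intro r hr hrx
        exact hx r (List.mem_cons_of_mem _ ((hmem r).mpr ⟨hr, by grind⟩)) hrx
      rcases List.mem_cons.mp hr with rfl | hr
      · exact (hins x hxS q hq).trans (by exact_mod_cast hle)
      · exact hins x hxS r ((hmem r).mp hr).1

theorem Dominates.issStep {m : ℕ} {g g' : U → ℤ} {S : ISSState U} (h : Dominates m g S)
    (p : U × Bool) (hp : g' p.1 = g p.1 + if p.2 then 1 else -1)
    (hne : ∀ x, x ≠ p.1 → g' x = g x) : Dominates m g' (issStep m S p) := by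
  have hne' : ∀ x, x ≠ p.1 → g' x ≤ g x := fun x hx => (hne x hx).le
  obtain ⟨e, b⟩ := p
  cases hf : S.find? (fun q => q.1 == e) with
  | some q =>
    have hqS := List.mem_of_find?_eq_some hf
    have hqe : q.1 = e := by simpa using List.find?_some hf
    have hest := h.le_estimate q hqS
    subst hqe
    cases b
    · simp only [SSPM.issStep, hf]
      refine h.replace hqS le_rfl (.inl rfl) ?_ hne'
      simp only [Bool.false_eq_true, if_false] at hp
      push_cast
      omega
    · simp only [SSPM.issStep, hf]
      refine h.replace hqS (Nat.le_succ _) (.inl rfl) ?_ hne'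
      simp only [if_true] at hp
      push_cast
      omega
  | none =>
    have hnot : ∀ r ∈ S, r.1 ≠ e := by simpa using hf
    cases b
    · simp only [SSPM.issStep, hf]
      have hle : ∀ x, g' x ≤ g x := by
        intro x
        by_cases hx : x = e
        · subst hx
          simp at hp
          omega
        · exact hne' x hx
      exact ⟨h.pairwise, fun q hq => (hle _).trans (h.le_estimate q hq),
        fun x hx hm => (hle _).trans (h.le_zero x hx hm),
        fun x hx q hq => (hle _).trans (h.le_insert x hx q hq)⟩
    · simp only [if_true] at hp
      simp only [SSPM.issStep, hf]
      split_ifs with hm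
      · have h0 := h.le_zero e hnot hm
        refine ⟨List.pairwise_cons.mpr ⟨fun r hr => (hnot r hr).symm, h.pairwise⟩, ?_, ?_, ?_⟩
        · intro r hr
          rcases List.mem_cons.mp hr with rfl | hr
          · push_cast
            omega
          · exact (hne' _ (hnot r hr)).trans (h.le_estimate r hr)
        all_goals
          intro x hx
          have hxe : x ≠ e := fun hxe => hx _ List.mem_cons_self hxe.symm
          have hx0 := (hne' x hxe).trans
            (h.le_zero x (fun r hr => hx r (List.mem_cons_of_mem _ hr)) hm)
        · exact fun _ => hx0
        · exact fun r _ => hx0.trans (by positivity)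
      · split
        · next q hq =>
          have hq' : q ∈ S.argmin (fun q => q.2.1) := hq
          have hqS := List.argmin_mem hq'
          have := h.le_insert e hnot q hqS
          refine h.replace hqS (Nat.le_succ _)
            (.inr ⟨hnot, not_lt.mp hm, fun r hr =>
              List.le_of_mem_argmin (f := fun q : U × ℕ × ℕ => q.2.1) hr hq'⟩) ?_ hne'
          push_cast
          omega
        · next hq =>
          have hS := List.argmin_eq_none.mp hq
          subst hS
          have : m = 0 := by simpa using hm
          subst this
          exact ⟨by simp, by simp, by simp, by simp⟩

theorem dominates_issRun (m : ℕ) (σ : Stream U) : Dominates m (freq σ) (issRun m σ) := by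
  induction σ using List.reverseRecOn with
  | nil => exact ⟨by simp [issRun], by simp [issRun], by simp [freq, insCount, delCount],
      by simp [issRun]⟩
  | append_singleton σ p ih =>
    have hrun : issRun m (σ ++ [p]) = SSPM.issStep m (issRun m σ) p := by simp [issRun]
    rw [hrun]
    refine ih.issStep p ?_ ?_
    · obtain ⟨e, b⟩ := p
      cases b <;> simp [freq, insCount, delCount, List.countP_append] <;> ring
    · intro x hx
      simp [freq, insCount, delCount, List.countP_append, hx.symm]

/-- After Integrated SpaceSaving± with m counters processes a valid
stream σ, every monitored item x satisfies f̂(x) ≥ f(x): the frequency of a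
monitored item is never underestimated. -/
theorem iss_no_underestimate (m : ℕ) (σ : Stream U) (hσ : Valid σ)
    (x : U) (hx : Monitored (issRun m σ) x) :
    freq σ x ≤ issQuery (issRun m σ) x := by
  obtain ⟨q, hq⟩ := Option.isSome_iff_exists.mp hx
  have hqx : q.1 = x := by simpa using List.find?_some hq
  subst hqx
  simpa only [issQuery, hq] using
    (dominates_issRun m σ).le_estimate q (List.mem_of_find?_eq_some hq)

end SSPM
end

section
/- Let ε > 0 and α ≥ 1, and let σ be a valid α-bounded-deletion stream. If m ≥ α/ε, then after Integrated SpaceSaving± with m counters processes σ, for every x : U, |f(x) − f̂(x)| ≤ ε·F1. -/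
/-!
Streams of insert/delete operations over a universe `U`, and the
Integrated SpaceSaving± summary, formalized as an association list
`List (U × ℕ × ℕ)` of (item, insert count, delete count) entries.
`true` encodes an insertion, `false` a deletion.
-/

namespace SSPM

variable {U : Type} [DecidableEq U]

theorem Valid.of_append {σ τ : Stream U} (h : Valid (σ ++ τ)) : Valid σ :=
  fun ρ hρ => h ρ (hρ.trans (List.prefix_append σ τ))

theorem Valid.delCount_le {σ : Stream U} (h : Valid σ) (x : U) : delCount σ x ≤ insCount σ x :=
  h σ List.prefix_rfl x

theorem insCount_append_ins (σ : Stream U) (e x : U) :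
    insCount (σ ++ [(e, true)]) x = insCount σ x + if e = x then 1 else 0 := by
  simp [insCount, List.countP_append, List.countP_singleton]

theorem insCount_append_del (σ : Stream U) (e x : U) :
    insCount (σ ++ [(e, false)]) x = insCount σ x := by
  simp [insCount, List.countP_append]

theorem delCount_append_ins (σ : Stream U) (e x : U) :
    delCount (σ ++ [(e, true)]) x = delCount σ x := by
  simp [delCount, List.countP_append]

theorem delCount_append_del (σ : Stream U) (e x : U) :
    delCount (σ ++ [(e, false)]) x = delCount σ x + if e = x then 1 else 0 := by
  simp [delCount, List.countP_append, List.countP_singleton]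

theorem totalI_append_ins {V : Type} (σ : Stream V) (e : V) :
    totalI (σ ++ [(e, true)]) = totalI σ + 1 := by
  simp [totalI, List.countP_append]

theorem totalI_append_del {V : Type} (σ : Stream V) (e : V) :
    totalI (σ ++ [(e, false)]) = totalI σ := by
  simp [totalI, List.countP_append]

theorem perm_cons_eraseP_of_find?_eq_some {A : Type*} {p : A → Bool} {l : List A} {a : A}
    (h : l.find? p = some a) : l.Perm (a :: l.eraseP p) := by
  induction l with
  | nil => simp at h
  | cons b l ih =>
    by_cases hb : p b
    · simp_all
    · simp only [List.find?_cons, hb, List.eraseP_cons] at h ⊢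
      exact ((ih h).cons b).trans (List.Perm.swap a b _)

theorem find?_eq_some_of_mem_of_nodup {S : ISSState U} {q : U × ℕ × ℕ}
    (hS : (S.map Prod.fst).Nodup) (hq : q ∈ S) : S.find? (fun r => r.1 == q.1) = some q := by
  induction S with
  | nil => simp at hq
  | cons b S ih =>
    simp only [List.map_cons, List.nodup_cons, List.mem_map, not_exists, not_and] at hS
    rcases List.mem_cons.1 hq with rfl | hq
    · simp
    · have hb : ¬ b.1 = q.1 := fun h => hS.1 q hq h.symm
      simpa [hb] using ih hS.2 hq

/-- The invariant of Integrated SpaceSaving±: `w` bounds the error of every estimate and is a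
lower bound for every insert count. -/
structure Summarizes (m w : ℕ) (σ : Stream U) (S : ISSState U) : Prop where
  nodup : (S.map Prod.fst).Nodup
  length_le : S.length ≤ m
  eq_zero : S.length < m → w = 0
  sum_eq : (S.map (fun q => q.2.1)).sum = totalI σ
  le_insert : ∀ q ∈ S, w ≤ q.2.1
  insCount_le : ∀ q ∈ S, insCount σ q.1 ≤ q.2.1
  abs_sub_le : ∀ q ∈ S, |freq σ q.1 - ((q.2.1 : ℤ) - (q.2.2 : ℤ))| ≤ w
  unmonitored : ∀ x, (∀ q ∈ S, q.1 ≠ x) → insCount σ x ≤ w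

theorem Summarizes.perm {m w : ℕ} {σ : Stream U} {S T : ISSState U}
    (h : Summarizes m w σ S) (hST : S.Perm T) : Summarizes m w σ T where
  nodup := (hST.map _).nodup_iff.1 h.nodup
  length_le := hST.length_eq ▸ h.length_le
  eq_zero := hST.length_eq ▸ h.eq_zero
  sum_eq := (hST.map (fun q => q.2.1)).sum_eq ▸ h.sum_eq
  le_insert q hq := h.le_insert q (hST.mem_iff.2 hq)
  insCount_le q hq := h.insCount_le q (hST.mem_iff.2 hq)
  abs_sub_le q hq := h.abs_sub_le q (hST.mem_iff.2 hq)
  unmonitored x hx := h.unmonitored x fun q hq => hx q (hST.mem_iff.1 hq)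

theorem Summarizes.insert_monitored {m w : ℕ} {σ : Stream U} {T : ISSState U} {e : U} {a b : ℕ}
    (h : Summarizes m w σ ((e, a, b) :: T)) :
    Summarizes m w (σ ++ [(e, true)]) ((e, a + 1, b) :: T) := by
  obtain ⟨h1, h2, h3, h4, h5, h6, h7, h8⟩ := h
  simp only [List.map_cons, List.length_cons, List.sum_cons, List.forall_mem_cons, freq] at *
  refine ⟨by simpa using h1, by simpa using h2, by simpa using h3, ?_, ?_, ?_, ?_, ?_⟩ <;>
    simp only [List.map_cons, List.sum_cons, List.forall_mem_cons, freq, insCount_append_ins,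
      delCount_append_ins, totalI_append_ins] at * <;> grind

theorem Summarizes.delete_monitored {m w : ℕ} {σ : Stream U} {T : ISSState U} {e : U} {a b : ℕ}
    (h : Summarizes m w σ ((e, a, b) :: T)) :
    Summarizes m w (σ ++ [(e, false)]) ((e, a, b + 1) :: T) := by
  obtain ⟨h1, h2, h3, h4, h5, h6, h7, h8⟩ := h
  simp only [List.map_cons, List.length_cons, List.sum_cons, List.forall_mem_cons, freq] at *
  refine ⟨by simpa using h1, by simpa using h2, by simpa using h3, ?_, ?_, ?_, ?_, ?_⟩ <;>
    simp only [List.map_cons, List.sum_cons, List.forall_mem_cons, freq, insCount_append_del,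
      delCount_append_del, totalI_append_del] at * <;> grind

theorem Summarizes.delete_unmonitored {m w : ℕ} {σ : Stream U} {S : ISSState U} {e : U}
    (h : Summarizes m w σ S) (he : ∀ q ∈ S, q.1 ≠ e) :
    Summarizes m w (σ ++ [(e, false)]) S := by
  obtain ⟨h1, h2, h3, h4, h5, h6, h7, h8⟩ := h
  refine ⟨h1, h2, h3, ?_, h5, ?_, ?_, ?_⟩ <;>
    simp only [freq, insCount_append_del, delCount_append_del, totalI_append_del] at * <;> grind

theorem Summarizes.insert_of_length_lt {m w : ℕ} {σ : Stream U} {S : ISSState U} {e : U}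
    (h : Summarizes m w σ S) (hσ : Valid σ) (he : ∀ q ∈ S, q.1 ≠ e) (hm : S.length < m) :
    Summarizes m w (σ ++ [(e, true)]) ((e, 1, 0) :: S) := by
  obtain ⟨h1, h2, h3, h4, h5, h6, h7, h8⟩ := h
  have hde := hσ.delCount_le e
  obtain rfl := h3 hm
  have hie := h8 e he
  refine ⟨by simpa using ⟨fun a b hab => he _ hab rfl, h1⟩, by simpa using hm, fun _ => rfl,
    ?_, ?_, ?_, ?_, ?_⟩ <;>
    simp only [List.map_cons, List.sum_cons, List.forall_mem_cons, freq, insCount_append_ins,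
      delCount_append_ins, totalI_append_ins] at * <;> grind

theorem Summarizes.insert_evict {m w : ℕ} {σ : Stream U} {T : ISSState U} {e : U}
    {q : U × ℕ × ℕ} (h : Summarizes m w σ (q :: T)) (hσ : Valid σ)
    (he : ∀ r ∈ q :: T, r.1 ≠ e) (hm : ¬ (q :: T).length < m) (hq : ∀ r ∈ T, q.2.1 ≤ r.2.1) :
    Summarizes m q.2.1 (σ ++ [(e, true)]) ((e, q.2.1 + 1, 0) :: T) := by
  obtain ⟨h1, h2, h3, h4, h5, h6, h7, h8⟩ := h
  have hde := hσ.delCount_le e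
  have hie := h8 e he
  simp only [List.map_cons, List.nodup_cons, List.length_cons, List.sum_cons,
    List.forall_mem_cons, freq] at *
  refine ⟨by simpa using ⟨fun a b hab => he.2 _ hab rfl, h1.2⟩, by simpa using h2,
    fun h => absurd h hm, ?_, ?_, ?_, ?_, fun x hx => ?_⟩
  on_goal 5 => by_cases hqx : q.1 = x
  all_goals
    simp only [List.map_cons, List.sum_cons, List.forall_mem_cons, freq, insCount_append_ins,
      delCount_append_ins, totalI_append_ins] at *
    grind

theorem Summarizes.exists_issStep {m w : ℕ} {σ : Stream U} {S : ISSState U}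
    (h : Summarizes m w σ S) (hm : 0 < m) (hσ : Valid σ) (p : U × Bool) :
    ∃ w', Summarizes m w' (σ ++ [p]) (issStep m S p) := by
  obtain ⟨e, _ | _⟩ := p
  all_goals
    rcases hf : S.find? (fun q => q.1 == e) with _ | ⟨e', a, b⟩
  · have he : ∀ q ∈ S, q.1 ≠ e := by simpa [List.find?_eq_none] using hf
    simp only [issStep, hf]
    exact ⟨w, h.delete_unmonitored he⟩
  · obtain rfl : e' = e := by simpa using List.find?_some hf
    simp only [issStep, hf]
    exact ⟨w, (h.perm (perm_cons_eraseP_of_find?_eq_some hf)).delete_monitored⟩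
  · have he : ∀ q ∈ S, q.1 ≠ e := by simpa [List.find?_eq_none] using hf
    simp only [issStep, hf]
    split_ifs with hlt
    · exact ⟨w, h.insert_of_length_lt hσ he hlt⟩
    · rcases hq : S.argmin (fun q => q.2.1) with _ | q
      · simp only [List.argmin_eq_none] at hq
        subst hq
        exact absurd hm hlt
      · have hqS : q ∈ S := List.argmin_mem hq
        have hp := perm_cons_eraseP_of_find?_eq_some (find?_eq_some_of_mem_of_nodup h.nodup hqS)
        simp only [hq]
        refine ⟨_, (h.perm hp).insert_evict hσ (fun r hr => he r (hp.mem_iff.2 hr))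
          (hp.length_eq ▸ hlt) fun r hr => ?_⟩
        exact List.le_of_mem_argmin (f := fun q => q.2.1)
          (hp.mem_iff.2 (List.mem_cons_of_mem _ hr)) hq
  · obtain rfl : e' = e := by simpa using List.find?_some hf
    simp only [issStep, hf]
    exact ⟨w, (h.perm (perm_cons_eraseP_of_find?_eq_some hf)).insert_monitored⟩

theorem exists_summarizes_issRun {m : ℕ} (hm : 0 < m) (σ : Stream U) (hσ : Valid σ) :
    ∃ w, Summarizes m w σ (issRun m σ) := by
  induction σ using List.reverseRecOn with
  | nil => exact ⟨0, by constructor <;> simp [issRun, totalI, insCount]⟩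
  | append_singleton σ p ih =>
    obtain ⟨w, hw⟩ := ih hσ.of_append
    simpa [issRun] using hw.exists_issStep hm hσ.of_append p

theorem Summarizes.mul_le_totalI {m w : ℕ} {σ : Stream U} {S : ISSState U}
    (h : Summarizes m w σ S) : m * w ≤ totalI σ := by
  rcases h.length_le.lt_or_eq with hlt | heq
  · simp [h.eq_zero hlt]
  · have := List.card_nsmul_le_sum (S.map (fun q => q.2.1)) w
      (List.forall_mem_map.2 h.le_insert)
    simpa [heq, h.sum_eq] using this

theorem Summarizes.abs_freq_sub_issQuery_le {m w : ℕ} {σ : Stream U} {S : ISSState U}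
    (h : Summarizes m w σ S) (hσ : Valid σ) (x : U) : |freq σ x - issQuery S x| ≤ w := by
  rcases hf : S.find? (fun q => q.1 == x) with _ | q
  · have hi := h.unmonitored x (by simpa [List.find?_eq_none] using hf)
    have hd := hσ.delCount_le x
    simp only [issQuery, hf, freq, abs_le]
    omega
  · obtain rfl : q.1 = x := by simpa using List.find?_some hf
    simpa only [issQuery, hf] using h.abs_sub_le q (List.mem_of_find?_eq_some hf)

/-- Let ε > 0, α ≥ 1, and σ a valid α-bounded-deletion stream.
If m ≥ α/ε, then after Integrated SpaceSaving± with m counters processes σ,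
for every x, |f(x) − f̂(x)| ≤ ε·F1. -/
theorem iss_frequency_estimation (ε α : ℝ) (hε : 0 < ε) (hα : 1 ≤ α)
    (σ : Stream U) (hv : Valid σ) (hb : BoundedDel α σ)
    (m : ℕ) (hm : α / ε ≤ (m : ℝ)) (x : U) :
    |(freq σ x : ℝ) - (issQuery (issRun m σ) x : ℝ)| ≤ ε * (F1 σ : ℝ) := by
  have hα0 : 0 < α := by linarith
  have hm0 : 0 < m := by exact_mod_cast (div_pos hα0 hε).trans_le hm
  obtain ⟨w, hw⟩ := exists_summarizes_issRun hm0 σ hv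
  have herr : |(freq σ x : ℝ) - (issQuery (issRun m σ) x : ℝ)| ≤ w := by
    exact_mod_cast hw.abs_freq_sub_issQuery_le hv x
  have hmw : (m : ℝ) * w ≤ totalI σ := by exact_mod_cast hw.mul_le_totalI
  have hF : (totalI σ : ℝ) / α ≤ F1 σ := by
    have hb' : (totalD σ : ℝ) ≤ (1 - 1 / α) * totalI σ := hb
    have : (F1 σ : ℝ) = totalI σ - totalD σ := by simp [F1]
    rw [this, div_eq_mul_one_div]
    linarith
  have hw' : α / ε * w ≤ totalI σ :=
    (mul_le_mul_of_nonneg_right hm (Nat.cast_nonneg w)).trans hmw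
  calc _ ≤ (w : ℝ) := herr
    _ = ε * (α / ε * w / α) := by field_simp
    _ ≤ ε * (totalI σ / α) := by gcongr
    _ ≤ ε * F1 σ := by gcongr

end SSPM
end

section
/- Let ε > 0 and α ≥ 1, and let σ be a valid α-bounded-deletion stream. If m_I ≥ 2α/ε, m_D ≥ 2(α−1)/ε and m_I, m_D ≥ 1, then after Double SpaceSaving± with (m_I, m_D) counters processes σ, for every x : U, |f(x) − f̂(x)| ≤ ε·F1. -/
/-!
Streams of insert/delete operations over a universe `U`, the insertion-only
SpaceSaving summary (association list `List (U × ℕ)` of (item, count) entries),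
and the Double SpaceSaving± algorithm, which runs one SpaceSaving summary on
the inserted items and one on the deleted items. `true` encodes an insertion,
`false` a deletion.
-/

namespace SSPM

variable {U : Type} [DecidableEq U]

/-- State of SpaceSaving: association list of (item, count). -/
abbrev SSState (U : Type) := List (U × ℕ)

/-- One step of the (insertion-only) SpaceSaving update algorithm with `m` counters. -/
def ssStep (m : ℕ) (S : SSState U) (e : U) : SSState U :=
  match S.find? (fun q => q.1 == e) with
  | some q => (e, q.2 + 1) :: S.eraseP (fun q => q.1 == e)
  | none =>
    if S.length < m then (e, 1) :: S
    else
      match S.argmin (fun q => q.2) with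
      | some q => (e, q.2 + 1) :: S.eraseP (fun r => r.1 == q.1)
      | none => S

/-- Run SpaceSaving with `m` counters on a list of items. -/
def ssRun (m : ℕ) (l : List U) : SSState U := l.foldl (ssStep m) []

/-- Query `Ŝ(x)`: the count of `x` if monitored, `0` otherwise. -/
def ssQuery (S : SSState U) (x : U) : ℕ :=
  match S.find? (fun q => q.1 == x) with
  | some q => q.2
  | none => 0

/-- The subsequence of items inserted in `σ`. -/
def insSeq (σ : Stream U) : List U := (σ.filter (fun p => p.2)).map Prod.fst

/-- The subsequence of items deleted in `σ`. -/
def delSeq (σ : Stream U) : List U := (σ.filter (fun p => !p.2)).map Prod.fst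

/-- Double SpaceSaving± query:
`f̂(x) = max(Ŝ_insert(x) − Ŝ_delete(x), 0)` where `S_insert = ssRun mI (insSeq σ)`
and `S_delete = ssRun mD (delSeq σ)`. -/
def dssQuery (mI mD : ℕ) (σ : Stream U) (x : U) : ℤ :=
  max ((ssQuery (ssRun mI (insSeq σ)) x : ℤ) - (ssQuery (ssRun mD (delSeq σ)) x : ℤ)) 0

/-- The invariant kept by SpaceSaving with `m` counters: `S` is a state reached after the items
of `l` have arrived. -/
structure SSInvariant (m : ℕ) (l : List U) (S : SSState U) : Prop where
  nodup_keys : (S.map Prod.fst).Nodup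
  length_le : S.length ≤ m
  sum_counts : (S.map Prod.snd).sum = l.length
  count_le : ∀ q ∈ S, l.count q.1 ≤ q.2
  le_count_add : ∀ q ∈ S, m * q.2 ≤ m * l.count q.1 + l.length
  count_eq_zero : S.length < m → ∀ x ∉ S.map Prod.fst, l.count x = 0
  count_le_of_notMem : ∀ x ∉ S.map Prod.fst, ∀ q ∈ S, l.count x ≤ q.2

theorem SSInvariant.perm {m : ℕ} {l : List U} {S T : SSState U} (h : SSInvariant m l S)
    (hp : S.Perm T) : SSInvariant m l T where
  nodup_keys := (hp.map _).nodup_iff.1 h.nodup_keys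
  length_le := hp.length_eq ▸ h.length_le
  sum_counts := (hp.map Prod.snd).sum_eq ▸ h.sum_counts
  count_le q hq := h.count_le q (hp.mem_iff.2 hq)
  le_count_add q hq := h.le_count_add q (hp.mem_iff.2 hq)
  count_eq_zero hl x hx :=
    h.count_eq_zero (hp.length_eq ▸ hl) x (fun hx' => hx ((hp.map _).mem_iff.1 hx'))
  count_le_of_notMem x hx q hq :=
    h.count_le_of_notMem x (fun hx' => hx ((hp.map _).mem_iff.1 hx')) q (hp.mem_iff.2 hq)

theorem perm_cons_eraseP_key {S : SSState U} (hS : (S.map Prod.fst).Nodup) {q : U × ℕ}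
    (hq : q ∈ S) : S.Perm (q :: S.eraseP (fun r => r.1 == q.1)) := by
  obtain ⟨a, l₁, l₂, -, ha, h, h'⟩ :=
    List.exists_of_eraseP (p := fun r : U × ℕ => r.1 == q.1) hq (by simp)
  have haS : a ∈ S := by simp [h]
  obtain rfl : a = q := List.inj_on_of_nodup_map hS haS hq (by simpa using ha)
  rw [h']
  nth_rewrite 1 [h]
  exact List.perm_middle

theorem count_append_singleton (l : List U) (e x : U) :
    (l ++ [e]).count x = l.count x + if e = x then 1 else 0 := by
  simp [List.count_append, List.count_singleton]

/-- Incrementing the counter of a monitored item. -/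
theorem SSInvariant.increment {m : ℕ} {l : List U} {e : U} {c : ℕ} {T : SSState U}
    (h : SSInvariant m l ((e, c) :: T)) : SSInvariant m (l ++ [e]) ((e, c + 1) :: T) := by
  obtain ⟨h1, h2, h3, h4, h5, h6, h7⟩ := h
  simp only [List.map_cons, List.nodup_cons, List.mem_cons, List.length_cons, List.sum_cons,
    not_or, forall_eq_or_imp] at *
  refine ⟨by simpa using h1, by simpa using h2, by simp; omega, ?_, ?_, ?_, ?_⟩
  · intro q hq
    rw [count_append_singleton]
    rcases List.mem_cons.1 hq with rfl | hq
    · simp; omega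
    · have := h4.2 q hq
      have hne : e ≠ q.1 := fun he => h1.1 (he ▸ List.mem_map_of_mem hq)
      simpa [hne] using this
  · intro q hq
    rw [count_append_singleton]
    rcases List.mem_cons.1 hq with rfl | hq
    · simp [mul_add]; omega
    · have := h5.2 q hq
      simp only [List.length_append, List.length_singleton, mul_add]
      omega
  · intro hl x hx
    simp only [List.map_cons, List.mem_cons, not_or] at hx
    rw [count_append_singleton, h6 (by simpa using hl) x hx]
    simp [Ne.symm hx.1]
  · intro x hx q hq
    simp only [List.map_cons, List.mem_cons, not_or] at hx
    have := h7 x hx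
    rw [count_append_singleton, if_neg (Ne.symm hx.1)]
    rcases List.mem_cons.1 hq with rfl | hq
    · simp; omega
    · simpa using this.2 q hq

/-- Replacing an entry of minimal count by a new item, when all counters are in use. -/
theorem SSInvariant.replace {m : ℕ} {l : List U} {e : U} {q : U × ℕ} {T : SSState U}
    (h : SSInvariant m l (q :: T)) (hm : (q :: T).length = m)
    (he : e ∉ (q :: T).map Prod.fst) (hmin : ∀ r ∈ q :: T, q.2 ≤ r.2) :
    SSInvariant m (l ++ [e]) ((e, q.2 + 1) :: T) := by
  have hsum : m * q.2 ≤ l.length := by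
    have := List.card_nsmul_le_sum ((q :: T).map Prod.snd) q.2 (by
      intro y hy
      obtain ⟨r, hr, rfl⟩ := List.mem_map.1 hy
      exact hmin r hr)
    rwa [h.sum_counts, List.length_map, hm, smul_eq_mul] at this
  obtain ⟨h1, h2, h3, h4, h5, h6, h7⟩ := h
  have hecount := h7 e he q List.mem_cons_self
  simp only [List.map_cons, List.nodup_cons, List.mem_cons, List.length_cons, List.sum_cons,
    not_or, forall_eq_or_imp] at *
  refine ⟨by simpa using ⟨by simpa using he.2, h1.2⟩, by simpa using h2, by simp; omega,
    ?_, ?_, ?_, ?_⟩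
  · intro r hr
    rw [count_append_singleton]
    rcases List.mem_cons.1 hr with rfl | hr
    · simp; omega
    · have := h4.2 r hr
      have hne : e ≠ r.1 := fun he' => he.2 (he' ▸ List.mem_map_of_mem hr)
      simpa [hne] using this
  · intro r hr
    rw [count_append_singleton]
    rcases List.mem_cons.1 hr with rfl | hr
    · simp [mul_add]; omega
    · have := h5.2 r hr
      simp only [List.length_append, List.length_singleton, mul_add]
      omega
  · intro hl
    simp only [List.length_cons] at hl
    omega
  · intro x hx r hr
    simp only [List.map_cons, List.mem_cons, not_or] at hx
    rw [count_append_singleton, if_neg (Ne.symm hx.1), add_zero]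
    have hxq : l.count x ≤ q.2 := by
      by_cases hxq : x = q.1
      · exact hxq ▸ h4.1
      · exact (h7 x ⟨hxq, hx.2⟩).1
    rcases List.mem_cons.1 hr with rfl | hr
    · exact hxq.trans (Nat.le_succ _)
    · exact hxq.trans (hmin.2 r hr)

/-- Starting to monitor a new item while a counter is free. -/
theorem SSInvariant.add {m : ℕ} {l : List U} {e : U} {S : SSState U}
    (h : SSInvariant m l S) (hm : S.length < m) (he : e ∉ S.map Prod.fst) :
    SSInvariant m (l ++ [e]) ((e, 1) :: S) := by
  obtain ⟨h1, h2, h3, h4, h5, h6, h7⟩ := h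
  have hzero := h6 hm
  refine ⟨List.nodup_cons.2 ⟨he, h1⟩, hm, by simp [h3]; omega, ?_, ?_, ?_, ?_⟩
  · intro r hr
    rw [count_append_singleton]
    rcases List.mem_cons.1 hr with rfl | hr
    · simp [hzero e he]
    · have hne : e ≠ r.1 := fun he' => he (he' ▸ List.mem_map_of_mem hr)
      simpa [hne] using h4 r hr
  · intro r hr
    rw [count_append_singleton]
    rcases List.mem_cons.1 hr with rfl | hr
    · simp [mul_add]; omega
    · have := h5 r hr
      simp only [List.length_append, List.length_singleton, mul_add]
      omega
  · intro _ x hx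
    simp only [List.map_cons, List.mem_cons, not_or] at hx
    rw [count_append_singleton, if_neg (Ne.symm hx.1), hzero x hx.2]
  · intro x hx r _
    simp only [List.map_cons, List.mem_cons, not_or] at hx
    rw [count_append_singleton, if_neg (Ne.symm hx.1), hzero x hx.2]
    exact Nat.zero_le _

theorem notMem_keys_of_find?_eq_none {S : SSState U} {e : U}
    (h : S.find? (fun q => q.1 == e) = none) : e ∉ S.map Prod.fst := by
  intro he
  obtain ⟨q, hq, rfl⟩ := List.mem_map.1 he
  simpa using List.find?_eq_none.1 h q hq

theorem SSInvariant.step {m : ℕ} (hm : 1 ≤ m) {l : List U} {S : SSState U}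
    (h : SSInvariant m l S) (e : U) : SSInvariant m (l ++ [e]) (ssStep m S e) := by
  unfold ssStep
  split
  next q hq =>
    obtain rfl : q.1 = e := by simpa using List.find?_some hq
    exact (h.perm (perm_cons_eraseP_key h.nodup_keys (List.mem_of_find?_eq_some hq))).increment
  next hnone =>
    have he := notMem_keys_of_find?_eq_none hnone
    split
    next hlt => exact h.add hlt he
    next hlt =>
      split
      next q hq =>
        have hp := perm_cons_eraseP_key h.nodup_keys (List.argmin_mem hq)
        refine (h.perm hp).replace ?_ (fun he' => he ((hp.map _).mem_iff.2 he'))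
          (fun r hr => List.le_of_mem_argmin (hp.mem_iff.2 hr) hq)
        rw [← hp.length_eq]
        exact le_antisymm h.length_le (not_lt.1 hlt)
      next hS =>
        rw [List.argmin_eq_none] at hS
        simp [hS] at hlt
        omega

theorem ssInvariant_ssRun {m : ℕ} (hm : 1 ≤ m) (l : List U) :
    SSInvariant m l (ssRun m l) := by
  induction l using List.reverseRecOn with
  | nil => constructor <;> simp [ssRun]
  | append_singleton l e ih =>
    rw [ssRun, List.foldl_append]
    exact ih.step hm e

/-- The SpaceSaving estimate errs by at most `l.length / m`. -/
theorem abs_count_sub_ssQuery_le {m : ℕ} (hm : 1 ≤ m) (l : List U) (x : U) :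
    (m : ℝ) * |(ssQuery (ssRun m l) x : ℝ) - (l.count x : ℝ)| ≤ l.length := by
  have h := ssInvariant_ssRun hm l
  unfold ssQuery
  split
  next q hq =>
    obtain rfl : q.1 = x := by simpa using List.find?_some hq
    have hmem := List.mem_of_find?_eq_some hq
    have hle : (l.count q.1 : ℝ) ≤ q.2 := by exact_mod_cast h.count_le q hmem
    have hge : (m : ℝ) * q.2 ≤ m * l.count q.1 + l.length := by
      exact_mod_cast h.le_count_add q hmem
    rw [abs_of_nonneg (by linarith)]
    linarith
  next hnone =>
    have hx := notMem_keys_of_find?_eq_none hnone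
    have hle : m * l.count x ≤ l.length := by
      rcases h.length_le.lt_or_eq with hlt | heq
      · simp [h.count_eq_zero hlt x hx]
      · have := List.card_nsmul_le_sum ((ssRun m l).map Prod.snd) (l.count x) (by
          intro y hy
          obtain ⟨r, hr, rfl⟩ := List.mem_map.1 hy
          exact h.count_le_of_notMem x hx r hr)
        rwa [h.sum_counts, List.length_map, heq, smul_eq_mul] at this
    simpa using (by exact_mod_cast hle : (m : ℝ) * l.count x ≤ l.length)

theorem length_insSeq {V : Type} (σ : Stream V) : (insSeq σ).length = totalI σ := by
  simp [insSeq, totalI, List.countP_eq_length_filter]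

theorem length_delSeq {V : Type} (σ : Stream V) : (delSeq σ).length = totalD σ := by
  simp [delSeq, totalD, List.countP_eq_length_filter]

theorem count_insSeq (σ : Stream U) (x : U) : (insSeq σ).count x = insCount σ x := by
  simp only [insSeq, insCount, List.count, List.countP_map, List.countP_filter]
  rfl

theorem count_delSeq (σ : Stream U) (x : U) : (delSeq σ).count x = delCount σ x := by
  simp only [delSeq, delCount, List.count, List.countP_map, List.countP_filter]
  rfl

/-- Let ε > 0, α ≥ 1, and σ a valid α-bounded-deletion stream.
If m_I ≥ 2α/ε, m_D ≥ 2(α−1)/ε and m_I, m_D ≥ 1, then after Double SpaceSaving±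
with (m_I, m_D) counters processes σ, for every x, |f(x) − f̂(x)| ≤ ε·F1. -/
theorem dss_frequency_estimation (ε α : ℝ) (hε : 0 < ε) (hα : 1 ≤ α)
    (σ : Stream U) (hv : Valid σ) (hb : BoundedDel α σ)
    (mI mD : ℕ) (hmI1 : 1 ≤ mI) (hmD1 : 1 ≤ mD)
    (hmI : 2 * α / ε ≤ (mI : ℝ)) (hmD : 2 * (α - 1) / ε ≤ (mD : ℝ)) (x : U) :
    |(freq σ x : ℝ) - (dssQuery mI mD σ x : ℝ)| ≤ ε * (F1 σ : ℝ) := by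
  have hα0 : 0 < α := by linarith
  have hI := abs_count_sub_ssQuery_le hmI1 (insSeq σ) x
  have hD := abs_count_sub_ssQuery_le hmD1 (delSeq σ) x
  rw [length_insSeq, count_insSeq] at hI
  rw [length_delSeq, count_delSeq] at hD
  have hf : (delCount σ x : ℝ) ≤ insCount σ x := by
    exact_mod_cast hv σ List.prefix_rfl x
  have hI0 : (0 : ℝ) ≤ totalI σ := Nat.cast_nonneg _
  have hF1 : α⁻¹ * (totalI σ : ℝ) ≤ (totalI σ : ℝ) - totalD σ := by
    unfold BoundedDel at hb
    rw [one_div] at hb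
    linarith
  have hmI0 : (0 : ℝ) < mI := by exact_mod_cast hmI1
  have hmD0 : (0 : ℝ) < mD := by exact_mod_cast hmD1
  rw [div_le_iff₀ hε] at hmI hmD
  have hb' : α * (totalD σ : ℝ) ≤ (α - 1) * totalI σ := by
    unfold BoundedDel at hb
    calc α * (totalD σ : ℝ) ≤ α * ((1 - 1 / α) * totalI σ) := by gcongr
      _ = (α - 1) * totalI σ := by field_simp
  have hIerr : |(ssQuery (ssRun mI (insSeq σ)) x : ℝ) - insCount σ x|
      ≤ ε / 2 * (α⁻¹ * totalI σ) := by
    refine le_of_mul_le_mul_left (hI.trans ?_) hmI0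
    calc (totalI σ : ℝ) = (2 * α) * (α⁻¹ * totalI σ / 2) := by field_simp
      _ ≤ (mI * ε) * (α⁻¹ * totalI σ / 2) := by gcongr
      _ = mI * (ε / 2 * (α⁻¹ * totalI σ)) := by ring
  have hDerr : |(ssQuery (ssRun mD (delSeq σ)) x : ℝ) - delCount σ x|
      ≤ ε / 2 * (α⁻¹ * totalI σ) := by
    refine le_of_mul_le_mul_left (hD.trans ?_) hmD0
    calc (totalD σ : ℝ) = α⁻¹ * (α * totalD σ) := by field_simp
      _ ≤ α⁻¹ * ((α - 1) * totalI σ) := by gcongr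
      _ = (2 * (α - 1)) * (α⁻¹ * totalI σ / 2) := by ring
      _ ≤ (mD * ε) * (α⁻¹ * totalI σ / 2) := by gcongr
      _ = mD * (ε / 2 * (α⁻¹ * totalI σ)) := by ring
  have hbound : ε * (α⁻¹ * totalI σ) ≤ ε * ((totalI σ : ℝ) - totalD σ) := by gcongr
  simp only [freq, dssQuery, F1]
  push_cast
  rw [abs_le] at hIerr hDerr
  have hnn : 0 ≤ ε * (α⁻¹ * totalI σ) := by positivity
  rw [abs_le]
  rcases max_cases ((ssQuery (ssRun mI (insSeq σ)) x : ℝ) - ssQuery (ssRun mD (delSeq σ)) x) 0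
    with ⟨h, h'⟩ | ⟨h, h'⟩ <;> rw [h] <;> constructor <;> linarith

end SSPM
end
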